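/- arXiv:1304.7344 — 2 statements merged into one kernel-verified Lean document; each statement's English description precedes it below -/
import Mathlib

section
/- Let V be a finite type, let F : Set (V × V) → Set V → ℝ satisfy: (i) for every E ⊆ V × V, the function F E is submodular; (ii) for all E, E' ⊆ V × V and every S ⊆ V, if {e ∈ E | e.1 ∈ S ∧ e.2 ∉ S} = {e ∈ E' | e.1 ∈ S ∧ e.2 ∉ S} then F E S = F E' S. Let s_1, …, s_n ∈ V and d ∈ V with d ≠ s_i for all i, let R_1, …, R_n ≥ 0, and let E₀ ⊆ V × V. Assume that for every S ⊆ V with d ∉ S, Σ_{i : s_i ∈ S} R_i ≤ F E₀ S. Then there exists an acyclic edge set E' ⊆ E₀ such that for every S ⊆ V with d ∉ S, Σ_{i : s_i ∈ S} R_i ≤ F E' S. -/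
open scoped Classical

/-- A function `g : Set V → ℝ` is submodular if
`g S1 + g S2 ≥ g (S1 ∪ S2) + g (S1 ∩ S2)` for all `S1, S2 ⊆ V`. -/
def Submodular {V : Type*} (g : Set V → ℝ) : Prop :=
  ∀ S1 S2 : Set V, g (S1 ∪ S2) + g (S1 ∩ S2) ≤ g S1 + g S2

/-- An edge set `E ⊆ V × V` is acyclic if the transitive closure of the corresponding
relation is irreflexive (no directed cycles; in particular no self-loops and no pair of
oppositely directed edges). -/
def AcyclicEdgeSet {V : Type*} (E : Set (V × V)) : Prop :=
  Irreflexive (Relation.TransGen fun u w => (u, w) ∈ E)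

/-- The sets avoiding `d` at which `g` attains its minimum over all sets avoiding `d`. -/
def minCuts {V : Type*} (g : Set V → ℝ) (d : V) : Set (Set V) :=
  {S | d ∉ S ∧ ∀ T : Set V, d ∉ T → g S ≤ g T}

theorem Submodular.exists_isGreatest_minCuts {V : Type*} [Finite V] {g : Set V → ℝ}
    (hg : Submodular g) (d : V) : ∃ S, IsGreatest (minCuts g d) S := by
  have hne : (minCuts g d).Nonempty := by
    obtain ⟨S, hS, hmin⟩ := Set.exists_min_image {S : Set V | d ∉ S} g (Set.toFinite _)
      ⟨∅, Set.notMem_empty d⟩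
    exact ⟨S, hS, hmin⟩
  obtain ⟨S, hS⟩ := (Set.toFinite (minCuts g d)).exists_maximal hne
  refine ⟨S, hS.1, fun T hT => ?_⟩
  have hunion : d ∉ S ∪ T := fun h => h.elim hS.1.1 hT.1
  have hinter : d ∉ S ∩ T := fun h => hS.1.1 h.1
  have hmem : S ∪ T ∈ minCuts g d := by
    refine ⟨hunion, fun U hU => ?_⟩
    have h1 := hg S T
    have h2 := hS.1.2 _ hinter
    have h3 := hT.2 _ hU
    linarith
  exact Set.subset_union_right.trans (hS.2 hmem Set.subset_union_left)

/-- If two set functions agree on all sets comparable to `S`, the second one is submodular and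
`S` is the greatest minimizer of the first, then `S` is the greatest minimizer of the second. -/
theorem IsGreatest.minCuts_congr {V : Type*} {g h : Set V → ℝ} {d : V} {S : Set V}
    (hS : IsGreatest (minCuts g d) S) (hh : Submodular h)
    (hinter : ∀ T : Set V, T ⊆ S → h T = g T) (hunion : ∀ T : Set V, S ⊆ T → h T = g T) :
    IsGreatest (minCuts h d) S := by
  have hgS := hinter S subset_rfl
  have key : ∀ T : Set V, d ∉ T → d ∉ T ∪ S ∧ g (T ∪ S) ≤ h T := by
    intro T hT
    have hu : d ∉ T ∪ S := fun h => h.elim hT hS.1.1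
    have h1 := hh T S
    rw [hinter _ Set.inter_subset_right, hunion _ Set.subset_union_right, hgS] at h1
    have h2 := hS.1.2 (T ∩ S) fun h => hT h.1
    exact ⟨hu, by linarith⟩
  refine ⟨⟨hS.1.1, fun T hT => ?_⟩, fun T hT => ?_⟩
  · obtain ⟨hu, hle⟩ := key T hT
    have := hS.1.2 _ hu
    linarith
  · obtain ⟨hu, hle⟩ := key T hT.1
    have hTS := hT.2 S hS.1.1
    refine Set.subset_union_left.trans (hS.2 ⟨hu, fun U hU => ?_⟩)
    have := hS.1.2 U hU
    linarith

/-- A finite family of sets closed under toggling, in each member `D`, an element `e D` that is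
the same for both sets of the pair, has even size. -/
theorem even_card_of_toggle {α : Type*} (s : Finset (Set α)) (e : Set α → α)
    (hmem : ∀ D ∈ s, symmDiff D {e D} ∈ s)
    (he : ∀ D ∈ s, e (symmDiff D {e D}) = e D) : Even s.card := by
  have hsum : ∑ _D ∈ s, (1 : ZMod 2) = 0 := by
    refine Finset.sum_involution (fun D _ => symmDiff D {e D}) (fun _ _ => by decide)
      (fun D _ _ h => ?_) hmem (fun D hD => ?_)
    · rw [symmDiff_eq_left] at h
      exact Set.singleton_ne_empty _ h
    · simp only [he D hD, symmDiff_symmDiff_cancel_right]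
  rw [Finset.sum_const, nsmul_one] at hsum
  exact (ZMod.natCast_eq_zero_iff_even).1 hsum

/-- Let `C` be a nonempty set of edges such that every cut left by an edge of `C` is also entered
by one.  If all cuts avoiding `d` have nonnegative value, this remains true after the removal of
some nonempty subset of `C`: the subsets whose removal makes a cut negative are paired off by
toggling an edge that enters the greatest minimizer, so their number is even. -/
theorem exists_nonempty_removable_subset {V : Type*} [Finite V]
    (G : Set (V × V) → Set V → ℝ) (hsub : ∀ E, Submodular (G E))
    (hout : ∀ E E' : Set (V × V), ∀ S : Set V,
      {e ∈ E | e.1 ∈ S ∧ e.2 ∉ S} = {e ∈ E' | e.1 ∈ S ∧ e.2 ∉ S} → G E S = G E' S)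
    (d : V) (E C : Set (V × V)) (hC : C.Nonempty)
    (hcirc : ∀ S : Set V, (∃ e ∈ C, e.1 ∈ S ∧ e.2 ∉ S) → ∃ e ∈ C, e.1 ∉ S ∧ e.2 ∈ S)
    (hE : ∀ S : Set V, d ∉ S → 0 ≤ G E S) :
    ∃ D ⊆ C, D.Nonempty ∧ ∀ S : Set V, d ∉ S → 0 ≤ G (E \ D) S := by
  have := Fintype.ofFinite (Set (V × V))
  by_contra! hno
  obtain ⟨e₀, he₀⟩ := hC
  have hsubset : ∀ D ⊆ C, ∀ e ∈ C, symmDiff D {e} ⊆ C := fun D hD e he =>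
    (symmDiff_le_sup (a := D) (b := {e})).trans
      (Set.union_subset hD (Set.singleton_subset_iff.2 he))
  have hall : Even (Finset.univ.filter fun D : Set (V × V) => D ⊆ C).card :=
    even_card_of_toggle _ (fun _ => e₀) (by simpa using fun D hD => hsubset D hD e₀ he₀)
      fun _ _ => rfl
  -- an edge of `C` entering `S`
  let enter : Set V → V × V := fun S =>
    if h : ∃ e ∈ C, e.1 ∉ S ∧ e.2 ∈ S then h.choose else e₀
  let M : Set (V × V) → Set V := fun D => sSup (minCuts (G (E \ D)) d)
  have hpair : ∀ D ⊆ C, D.Nonempty →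
      symmDiff D {enter (M D)} ⊆ C ∧ (symmDiff D {enter (M D)}).Nonempty ∧
        M (symmDiff D {enter (M D)}) = M D := by
    intro D hD hDne
    obtain ⟨S, hS⟩ := (hsub (E \ D)).exists_isGreatest_minCuts d
    have hM : M D = S := hS.isLUB.sSup_eq
    have hneg : G (E \ D) S < 0 := by
      obtain ⟨T, hT, hlt⟩ := hno D hD hDne
      exact (hS.1.2 T hT).trans_lt hlt
    have hexit : ∃ e ∈ D, e.1 ∈ S ∧ e.2 ∉ S := by
      by_contra! hcon
      have : G (E \ D) S = G E S := hout _ _ _ <| by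
        ext e
        simp only [Set.mem_sep_iff, Set.mem_sdiff]
        exact ⟨fun h => ⟨h.1.1, h.2⟩, fun h => ⟨⟨h.1, fun h' => h.2.2 (hcon e h' h.2.1)⟩, h.2⟩⟩
      exact absurd (hE S hS.1.1) (by linarith)
    have henter := hcirc S (hexit.imp fun e h => ⟨hD h.1, h.2⟩)
    obtain ⟨hmem, htail, hhead⟩ : enter S ∈ C ∧ (enter S).1 ∉ S ∧ (enter S).2 ∈ S := by
      simp only [enter, dif_pos henter]
      exact henter.choose_spec
    rw [hM]
    generalize enter S = e at hmem htail hhead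
    have hagree : ∀ T : Set V, (e.1 ∉ T ∨ e.2 ∈ T) →
        G (E \ symmDiff D {e}) T = G (E \ D) T := by
      intro T hT
      refine hout _ _ _ (Set.ext fun x => ?_)
      by_cases hx : x = e
      · subst hx
        simp only [Set.mem_sep_iff]
        tauto
      · simp [Set.mem_symmDiff, hx]
    have hS' : IsGreatest (minCuts (G (E \ symmDiff D {e})) d) S :=
      hS.minCuts_congr (hsub _) (fun T hT => hagree T (Or.inl fun h => htail (hT h)))
        fun T hT => hagree T (Or.inr (hT hhead))
    refine ⟨hsubset D hD e hmem, ?_, hS'.isLUB.sSup_eq⟩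
    obtain ⟨x, hx, hxS, -⟩ := hexit
    exact ⟨x, Or.inl ⟨hx, fun h => htail (Set.mem_singleton_iff.1 h ▸ hxS)⟩⟩
  have hbad : Even (Finset.univ.filter fun D : Set (V × V) => D ⊆ C ∧ D.Nonempty).card := by
    refine even_card_of_toggle _ (fun D => enter (M D)) (fun D hD => ?_) (fun D hD => ?_) <;>
      obtain ⟨h1, h2, h3⟩ := hpair D (Finset.mem_filter.1 hD).2.1 (Finset.mem_filter.1 hD).2.2
    · exact Finset.mem_filter.2 ⟨Finset.mem_univ _, h1, h2⟩
    · simp only [h3]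
  have hsplit : (Finset.univ.filter fun D : Set (V × V) => D ⊆ C) =
      insert ∅ (Finset.univ.filter fun D : Set (V × V) => D ⊆ C ∧ D.Nonempty) := by
    ext D
    rcases D.eq_empty_or_nonempty with rfl | h
    · simp
    · simp [h, h.ne_empty]
  rw [hsplit, Finset.card_insert_of_notMem (by simp)] at hall
  exact (Nat.even_add_one.1 hall) hbad

/-- A family of edge cuts with nonnegative values on the sets avoiding `d` retains this property
on some acyclic edge subset. -/
theorem exists_acyclic_subset_nonneg_cuts {V : Type*} [Finite V]
    (G : Set (V × V) → Set V → ℝ) (hsub : ∀ E, Submodular (G E))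
    (hout : ∀ E E' : Set (V × V), ∀ S : Set V,
      {e ∈ E | e.1 ∈ S ∧ e.2 ∉ S} = {e ∈ E' | e.1 ∈ S ∧ e.2 ∉ S} → G E S = G E' S)
    (d : V) (E₀ : Set (V × V)) (hE₀ : ∀ S : Set V, d ∉ S → 0 ≤ G E₀ S) :
    ∃ E ⊆ E₀, AcyclicEdgeSet E ∧ ∀ S : Set V, d ∉ S → 0 ≤ G E S := by
  obtain ⟨E, hE⟩ := (Set.toFinite {E : Set (V × V) |
    E ⊆ E₀ ∧ ∀ S : Set V, d ∉ S → 0 ≤ G E S}).exists_minimal ⟨E₀, subset_rfl, hE₀⟩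
  refine ⟨E, hE.1.1, fun v hv => ?_, hE.1.2⟩
  let r : V → V → Prop := fun u w => (u, w) ∈ E
  let C : Set (V × V) := {e | e ∈ E ∧ Relation.ReflTransGen r e.2 e.1}
  have hC : C.Nonempty := by
    obtain ⟨w, hvw, hwv⟩ := Relation.TransGen.head'_iff.1 hv
    exact ⟨(v, w), hvw, hwv⟩
  have hcirc : ∀ S : Set V, (∃ e ∈ C, e.1 ∈ S ∧ e.2 ∉ S) → ∃ e ∈ C, e.1 ∉ S ∧ e.2 ∈ S := by
    rintro S ⟨⟨u, w⟩, ⟨huw, hwu⟩, hu, hw⟩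
    have henter : ∀ x, Relation.ReflTransGen r w x → x ∈ S →
        ∃ a b, r a b ∧ a ∉ S ∧ b ∈ S ∧ Relation.ReflTransGen r w a ∧
          Relation.ReflTransGen r b x := by
      intro x hx
      induction hx with
      | refl => exact fun h => absurd h hw
      | @tail y z hwy hyz ih =>
        intro hz
        by_cases hy : y ∈ S
        · obtain ⟨a, b, hab, ha, hb, hwa, hby⟩ := ih hy
          exact ⟨a, b, hab, ha, hb, hwa, hby.tail hyz⟩
        · exact ⟨y, z, hyz, hy, hz, hwy, .refl⟩
    obtain ⟨a, b, hab, ha, hb, hwa, hbu⟩ := henter u hwu hu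
    exact ⟨(a, b), ⟨hab, (hbu.tail huw).trans hwa⟩, ha, hb⟩
  obtain ⟨D, hDC, ⟨x, hx⟩, hD⟩ :=
    exists_nonempty_removable_subset G hsub hout d E C hC hcirc hE.1.2
  have hmin : E ⊆ E \ D :=
    hE.2 ⟨Set.sdiff_subset.trans hE.1.1, hD⟩ Set.sdiff_subset
  exact (hmin (hDC hx).1).2 hx

/-- (Abstract multiple access.)  For any family of cut functions `F`
that is submodular and whose values depend only on the edges going out of the cut, if
the rate tuple `(R 1, …, R n)` lies in the cutset region of the multiple-access network
with edge set `E₀`, sources `sc 1, …, sc n` and destination `d`, then it lies in the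
cutset region of some acyclic subnetwork `E' ⊆ E₀`. -/
theorem exists_acyclic_subnetwork_multiple_access {V : Type*} [Fintype V]
    (F : Set (V × V) → Set V → ℝ)
    (hsub : ∀ E : Set (V × V), Submodular (F E))
    (hout : ∀ E E' : Set (V × V), ∀ S : Set V,
      {e ∈ E | e.1 ∈ S ∧ e.2 ∉ S} = {e ∈ E' | e.1 ∈ S ∧ e.2 ∉ S} → F E S = F E' S)
    (n : ℕ) (sc : Fin n → V) (d : V) (hd : ∀ i, d ≠ sc i)
    (R : Fin n → ℝ) (hR : ∀ i, 0 ≤ R i)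
    (E₀ : Set (V × V))
    (hrate : ∀ S : Set V, d ∉ S →
      ∑ i ∈ Finset.univ.filter (fun i => sc i ∈ S), R i ≤ F E₀ S) :
    ∃ E' ⊆ E₀, AcyclicEdgeSet E' ∧
      ∀ S : Set V, d ∉ S →
        ∑ i ∈ Finset.univ.filter (fun i => sc i ∈ S), R i ≤ F E' S := by
  have hmod : ∀ S T U W : Set V, U = S ∪ T → W = S ∩ T →
      (∑ i ∈ Finset.univ.filter (fun i => sc i ∈ U), R i) +
        ∑ i ∈ Finset.univ.filter (fun i => sc i ∈ W), R i =
      (∑ i ∈ Finset.univ.filter (fun i => sc i ∈ S), R i) +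
        ∑ i ∈ Finset.univ.filter (fun i => sc i ∈ T), R i := by
    rintro S T U W rfl rfl
    simp only [Set.mem_union, Set.mem_inter_iff, Finset.filter_or, Finset.filter_and]
    exact Finset.sum_union_inter
  obtain ⟨E, hE, hacyc, hcut⟩ := exists_acyclic_subset_nonneg_cuts
    (fun E S => F E S - ∑ i ∈ Finset.univ.filter (fun i => sc i ∈ S), R i)
    (fun E S T => by
      have h1 := hsub E S T
      have h2 := hmod S T _ _ rfl rfl
      linarith)
    (fun E E' S h => by simp only [hout E E' S h])
    d E₀ (fun S hS => sub_nonneg.2 (hrate S hS))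
  exact ⟨E, hE, hacyc, fun S hS => sub_nonneg.1 (hcut S hS)⟩
end

section
/- Let V be a finite type, let F : Set (V × V) → Set V → ℝ satisfy: (i) for every E ⊆ V × V, the function F E is submodular; (ii) for all E, E' ⊆ V × V and every S ⊆ V, if {e ∈ E | e.1 ∈ S ∧ e.2 ∉ S} = {e ∈ E' | e.1 ∈ S ∧ e.2 ∉ S} then F E S = F E' S. Let s ∈ V and d_1, …, d_n ∈ V with s ≠ d_i for all i, let R_1, …, R_n ≥ 0, and let E₀ ⊆ V × V. Assume that for every S ⊆ V with s ∈ S, Σ_{i : d_i ∉ S} R_i ≤ F E₀ S. Then there exists an acyclic edge set E' ⊆ E₀ such that for every S ⊆ V with s ∈ S, Σ_{i : d_i ∉ S} R_i ≤ F E' S. -/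
open scoped Classical

/-- Let `𝓕` be a nonempty finite family in a lattice such that any two incomparable members have
a join or meet in `𝓕` on which `g` is smaller than the larger of the two values.
Then `𝓕` has an even number of chains, the empty chain included. -/
theorem even_card_chains {α β : Type*} [Lattice α] [LinearOrder β] (g : α → β) (𝓕 : Finset α)
    (hne : 𝓕.Nonempty)
    (h : ∀ A ∈ 𝓕, ∀ B ∈ 𝓕, ¬ A ≤ B → ¬ B ≤ A →
      ∃ C ∈ 𝓕, (C = A ⊔ B ∨ C = A ⊓ B) ∧ g C < max (g A) (g B)) :
    Even (𝓕.powerset.filter (fun K : Finset α => IsChain (· ≤ ·) (K : Set α))).card := by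
  induction 𝓕 using Finset.strongInduction with
  | H 𝓕 ih =>
  obtain ⟨T, hT, hmax⟩ := 𝓕.exists_max_image g hne
  set 𝓓 := 𝓕.erase T
  set 𝓖 := 𝓓.filter (fun A => A ≤ T ∨ T ≤ A)
  have hlt : ∀ A ∈ 𝓕, ∀ B ∈ 𝓕, ∀ C, g C < max (g A) (g B) → C ≠ T := by
    rintro A hA B hB C hC rfl
    exact absurd hC (not_lt.2 (max_le (hmax A hA) (hmax B hB)))
  have hT𝓓 : T ∉ 𝓓 := Finset.notMem_erase T 𝓕
  have hcard : (𝓕.powerset.filter (fun K : Finset α => IsChain (· ≤ ·) (K : Set α))).card =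
      (𝓓.powerset.filter (fun K : Finset α => IsChain (· ≤ ·) (K : Set α))).card +
      (𝓖.powerset.filter (fun K : Finset α => IsChain (· ≤ ·) (K : Set α))).card := by
    have himg : (𝓓.powerset.image (insert T)).filter
          (fun K : Finset α => IsChain (· ≤ ·) (K : Set α)) =
        (𝓖.powerset.filter
          (fun K : Finset α => IsChain (· ≤ ·) (K : Set α))).image (insert T) := by
      ext K
      simp only [Finset.mem_filter, Finset.mem_image, Finset.mem_powerset]
      constructor
      · rintro ⟨⟨L, hL, rfl⟩, hK⟩
        rw [Finset.coe_insert] at hK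
        refine ⟨L, ⟨fun A hA => ?_, hK.mono (Set.subset_insert _ _)⟩, rfl⟩
        exact Finset.mem_filter.2 ⟨hL hA,
          hK.total (Set.mem_insert_of_mem _ hA) (Set.mem_insert _ _)⟩
      · rintro ⟨L, ⟨hL, hK⟩, rfl⟩
        refine ⟨⟨L, hL.trans (Finset.filter_subset _ _), rfl⟩, ?_⟩
        rw [Finset.coe_insert]
        exact hK.insert fun A hA _ => (Finset.mem_filter.1 (hL hA)).2.symm
    rw [← Finset.insert_erase hT, Finset.powerset_insert, Finset.filter_union, himg,
      Finset.card_union_of_disjoint, Finset.card_image_of_injOn]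
    · intro K hK L hL hKL
      have hnot : ∀ M ∈ 𝓖.powerset.filter (fun K : Finset α => IsChain (· ≤ ·) (K : Set α)), T ∉ M :=
        fun M hM hTM => hT𝓓 (Finset.mem_filter.1
          (Finset.mem_powerset.1 (Finset.mem_filter.1 hM).1 hTM)).1
      rw [← Finset.erase_insert (hnot K hK), ← Finset.erase_insert (hnot L hL)]
      exact congrArg (fun M => M.erase T) hKL
    · rw [Finset.disjoint_left]
      intro K hK hK'
      obtain ⟨L, -, rfl⟩ := Finset.mem_image.1 hK'
      exact hT𝓓 (Finset.mem_powerset.1 (Finset.mem_filter.1 hK).1 (Finset.mem_insert_self _ _))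
  rw [hcard]
  have h𝓓𝓕 : 𝓓 ⊂ 𝓕 := Finset.erase_ssubset hT
  have h𝓖𝓓 : 𝓖 ⊆ 𝓓 := Finset.filter_subset _ _
  by_cases h0 : 𝓓.Nonempty
  · have h𝓖ne : 𝓖.Nonempty := by
      obtain ⟨A, hA⟩ := h0
      have hA' := Finset.mem_of_mem_erase hA
      by_cases hc : A ≤ T ∨ T ≤ A
      · exact ⟨A, Finset.mem_filter.2 ⟨hA, hc⟩⟩
      · push Not at hc
        obtain ⟨C, hC, hCe, hg⟩ := h A hA' T hT hc.1 hc.2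
        refine ⟨C, Finset.mem_filter.2 ⟨Finset.mem_erase.2 ⟨hlt A hA' T hT C hg, hC⟩, ?_⟩⟩
        rcases hCe with rfl | rfl
        · exact Or.inr le_sup_right
        · exact Or.inl inf_le_right
    refine (ih 𝓓 h𝓓𝓕 h0 ?_).add (ih 𝓖 (h𝓖𝓓.trans_ssubset h𝓓𝓕) h𝓖ne ?_)
    · intro A hA B hB hAB hBA
      have hA' := Finset.mem_of_mem_erase hA
      have hB' := Finset.mem_of_mem_erase hB
      obtain ⟨C, hC, hCe, hg⟩ := h A hA' B hB' hAB hBA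
      exact ⟨C, Finset.mem_erase.2 ⟨hlt A hA' B hB' C hg, hC⟩, hCe, hg⟩
    · intro A hA B hB hAB hBA
      obtain ⟨hA, hAT⟩ := Finset.mem_filter.1 hA
      obtain ⟨hB, hBT⟩ := Finset.mem_filter.1 hB
      have hA' := Finset.mem_of_mem_erase hA
      have hB' := Finset.mem_of_mem_erase hB
      obtain ⟨C, hC, hCe, hg⟩ := h A hA' B hB' hAB hBA
      refine ⟨C, Finset.mem_filter.2 ⟨Finset.mem_erase.2 ⟨hlt A hA' B hB' C hg, hC⟩, ?_⟩, hCe, hg⟩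
      rcases hAT with hAT | hAT <;> rcases hBT with hBT | hBT
      · left; rcases hCe with rfl | rfl
        · exact sup_le hAT hBT
        · exact inf_le_left.trans hAT
      · exact absurd (hAT.trans hBT) hAB
      · exact absurd (hBT.trans hAT) hBA
      · right; rcases hCe with rfl | rfl
        · exact hAT.trans le_sup_left
        · exact le_inf hAT hBT
  · rw [Finset.not_nonempty_iff_eq_empty] at h0
    have h1 : 𝓖 = ∅ := Finset.subset_empty.1 (h0 ▸ h𝓖𝓓)
    rw [h0, h1]
    exact ⟨_, rfl⟩

/-- The chains of a nonempty family of strict sublevel sets of a submodular function, restricted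
to the sets containing a given point, are even in number. -/
theorem even_card_chains_of_submodular {V : Type*} [Fintype V] {h : Set V → ℝ}
    (hh : Submodular h) (s : V)
    (hne : (Finset.univ.filter (fun T : Set V => s ∈ T ∧ h T < 0)).Nonempty) :
    Even ((Finset.univ.filter (fun T : Set V => s ∈ T ∧ h T < 0)).powerset.filter
      (fun K : Finset (Set V) => IsChain (· ≤ ·) (K : Set (Set V)))).card := by
  refine even_card_chains (fun T : Set V => toLex (h T, Tᶜ.ncard)) _ hne ?_
  intro A hA B hB hAB hBA
  simp only [Finset.mem_filter, Finset.mem_univ, true_and] at hA hB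
  have hsub := hh A B
  simp only [Finset.mem_filter, Finset.mem_univ, true_and, lt_max_iff, Prod.Lex.toLex_lt_toLex]
  by_cases h1 : h (A ∪ B) < max (h A) (h B)
  · exact ⟨A ∪ B, ⟨Or.inl hA.1, h1.trans (max_lt hA.2 hB.2)⟩, Or.inl rfl,
      (lt_max_iff.1 h1).imp Or.inl Or.inl⟩
  by_cases h2 : h (A ∩ B) < max (h A) (h B)
  · exact ⟨A ∩ B, ⟨⟨hA.1, hB.1⟩, h2.trans (max_lt hA.2 hB.2)⟩, Or.inr rfl,
      (lt_max_iff.1 h2).imp Or.inl Or.inl⟩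
  rw [not_lt, max_le_iff] at h1 h2
  have heq : h (A ∪ B) = h A := by linarith
  refine ⟨A ∪ B, ⟨Or.inl hA.1, heq ▸ hA.2⟩, Or.inl rfl, Or.inl (Or.inr ⟨heq, ?_⟩)⟩
  refine Set.ncard_lt_ncard (compl_lt_compl_iff_lt.2 ?_)
  exact ⟨Set.subset_union_left, fun hc => hBA (Set.subset_union_right.trans hc)⟩

/-- A path from outside `T` to inside `T` has an edge entering `T`. -/
theorem Relation.ReflTransGen.exists_step_into {V : Type*} {r : V → V → Prop} {a b : V}
    (h : Relation.ReflTransGen r a b) {T : Set V} (ha : a ∉ T) (hb : b ∈ T) :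
    ∃ x y, Relation.ReflTransGen r a x ∧ r x y ∧ Relation.ReflTransGen r y b ∧
      x ∉ T ∧ y ∈ T := by
  induction h with
  | refl => exact absurd hb ha
  | @tail b c hab hbc ih =>
    by_cases hbT : b ∈ T
    · obtain ⟨x, y, hax, hxy, hyb, hx, hy⟩ := ih hbT
      exact ⟨x, y, hax, hxy, hyb.tail hbc, hx, hy⟩
    · exact ⟨b, c, hab, hbc, .refl, hbT, hb⟩

/-- The edges of `E` that lie on a directed cycle of `E`. -/
def cyclicEdges {V : Type*} (E : Set (V × V)) : Set (V × V) :=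
  {e ∈ E | Relation.ReflTransGen (fun u w => (u, w) ∈ E) e.2 e.1}

theorem cyclicEdges_nonempty {V : Type*} {E : Set (V × V)} (hE : ¬ AcyclicEdgeSet E) :
    (cyclicEdges E).Nonempty := by
  have hE' : ∃ v, Relation.TransGen (fun u w => (u, w) ∈ E) v v := by
    by_contra! hc
    exact hE hc
  obtain ⟨v, hv⟩ := hE'
  obtain ⟨w, hvw, hwv⟩ := Relation.TransGen.head'_iff.1 hv
  exact ⟨(v, w), hvw, hwv⟩

/-- If every member of a chain of sets is left by some edge lying on a cycle, then some edge lying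
on a cycle leaves none of them. -/
theorem exists_cyclicEdge_not_leaving {V : Type*} {E : Set (V × V)}
    (hE : (cyclicEdges E).Nonempty) (K : Finset (Set V))
    (hK : IsChain (· ≤ ·) (K : Set (Set V)))
    (hcut : ∀ T ∈ K, ∃ e ∈ cyclicEdges E, e.1 ∈ T ∧ e.2 ∉ T) :
    ∃ e ∈ cyclicEdges E, ∀ T ∈ K, ¬ (e.1 ∈ T ∧ e.2 ∉ T) := by
  rcases K.eq_empty_or_nonempty with rfl | hne
  · obtain ⟨e, he⟩ := hE
    exact ⟨e, he, by simp⟩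
  obtain ⟨T, hTK, hT⟩ := K.exists_minimal hne
  obtain ⟨⟨a, b⟩, ⟨hab, hba⟩, ha, hb⟩ := hcut T hTK
  obtain ⟨x, y, hbx, hxy, hya, -, hy⟩ := hba.exists_step_into hb ha
  refine ⟨(x, y), ⟨hxy, (hya.tail hab).trans hbx⟩, fun U hU hxyU => hxyU.2 ?_⟩
  rcases hK.total hTK hU with hle | hle
  · exact hle hy
  · exact hT hU hle hy

/-- If a modular lower bound `m` holds for `F E` on the sets containing `s` and fails after
deleting any nonempty set of edges lying on cycles of `E`, then `E` is acyclic. -/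
theorem acyclicEdgeSet_of_minimal {V : Type*} [Fintype V]
    (F : Set (V × V) → Set V → ℝ)
    (hsub : ∀ E : Set (V × V), Submodular (F E))
    (hout : ∀ E E' : Set (V × V), ∀ S : Set V,
      {e ∈ E | e.1 ∈ S ∧ e.2 ∉ S} = {e ∈ E' | e.1 ∈ S ∧ e.2 ∉ S} → F E S = F E' S)
    (s : V) (m : Set V → ℝ) (hm : ∀ A B, m (A ∪ B) + m (A ∩ B) = m A + m B)
    (E : Set (V × V)) (hE : ∀ S, s ∈ S → m S ≤ F E S)
    (hmin : ∀ D ⊆ E, D.Nonempty → ∃ S, s ∈ S ∧ F (E \ D) S < m S) :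
    AcyclicEdgeSet E := by
  by_contra hcyc
  have hC := cyclicEdges_nonempty hcyc
  set C := cyclicEdges E
  have hCE : C ⊆ E := fun e he => he.1
  let 𝓕 : Finset (V × V) → Finset (Set V) := fun D =>
    Finset.univ.filter (fun T => s ∈ T ∧ F (E \ D) T - m T < 0)
  have mem𝓕 : ∀ D T, T ∈ 𝓕 D ↔ s ∈ T ∧ F (E \ D) T < m T := fun D T => by
    simp [𝓕]
  have heven : ∀ D ∈ C.toFinset.powerset, D ≠ ∅ →
      Even ((𝓕 D).powerset.filter
        (fun K : Finset (Set V) => IsChain (· ≤ ·) (K : Set (Set V)))).card := by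
    intro D hD hD0
    refine even_card_chains_of_submodular (h := fun T => F (E \ D) T - m T) ?_ s ?_
    · intro A B
      linarith [hsub (E \ D) A B, hm A B]
    · have hDC : (D : Set (V × V)) ⊆ C := fun e he =>
        Set.mem_toFinset.1 (Finset.mem_powerset.1 hD he)
      obtain ⟨S, hS⟩ := hmin D (hDC.trans hCE) (Finset.nonempty_iff_ne_empty.2 hD0)
      exact ⟨S, (mem𝓕 D S).2 hS⟩
  have hempty : 𝓕 ∅ = ∅ := by
    refine Finset.eq_empty_of_forall_notMem fun T hT => ?_
    rw [mem𝓕, Finset.coe_empty, Set.sdiff_empty] at hT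
    exact absurd hT.2 (not_lt.2 (hE T hT.1))
  have hcut : ∀ D ⊆ C.toFinset, ∀ T ∈ 𝓕 D, ∃ e ∈ C, e.1 ∈ T ∧ e.2 ∉ T := by
    intro D hD T hT
    rw [mem𝓕] at hT
    by_contra! hc
    refine absurd hT.2 (not_lt.2 ?_)
    rw [hout (E \ D) E T]
    · exact hE T hT.1
    · ext e
      have := fun he : e ∈ D => hc e (Set.mem_toFinset.1 (hD he))
      simp only [Set.mem_sdiff, Set.mem_ofPred_eq, Finset.mem_coe]
      tauto
  have htoggle : ∀ (e : V × V) (T : Set V), ¬ (e.1 ∈ T ∧ e.2 ∉ T) → ∀ D,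
      T ∈ 𝓕 D → T ∈ 𝓕 (symmDiff D {e}) := by
    intro e T he D hT
    rw [mem𝓕] at hT ⊢
    refine ⟨hT.1, ?_⟩
    rw [hout (E \ ↑(symmDiff D {e})) (E \ D) T]
    · exact hT.2
    · ext f
      by_cases hf : f = e
      · subst hf
        simp only [Set.mem_ofPred_eq]
        tauto
      · simp [Set.mem_symmDiff, hf]
  have hzero : ∑ D ∈ C.toFinset.powerset, ∑ K : Finset (Set V),
      (if K ⊆ 𝓕 D ∧ IsChain (· ≤ ·) (K : Set (Set V)) then (1 : ZMod 2) else 0) = 0 := by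
    rw [Finset.sum_comm]
    refine Finset.sum_eq_zero fun K _ => ?_
    rw [← Finset.sum_filter]
    rcases (C.toFinset.powerset.filter (fun D => K ⊆ 𝓕 D ∧
      IsChain (· ≤ ·) (K : Set (Set V)))).eq_empty_or_nonempty with h0 | ⟨D₀, hD₀⟩
    · rw [h0, Finset.sum_empty]
    rw [Finset.mem_filter, Finset.mem_powerset] at hD₀
    obtain ⟨e, heC, he⟩ := exists_cyclicEdge_not_leaving hC K hD₀.2.2
      fun T hT => hcut D₀ hD₀.1 T (hD₀.2.1 hT)
    refine Finset.sum_involution (fun D _ => symmDiff D {e}) ?_ ?_ ?_ ?_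
    · intro D _
      exact CharTwo.add_self_eq_zero 1
    · intro D _ _ hD
      rw [symmDiff_eq_left] at hD
      exact Finset.singleton_ne_empty e hD
    · intro D hD
      rw [Finset.mem_filter, Finset.mem_powerset] at hD ⊢
      refine ⟨?_, fun T hT => htoggle e T (he T hT) D (hD.2.1 hT), hD.2.2⟩
      intro f hf
      rcases Finset.mem_symmDiff.1 hf with hf | hf
      · exact hD.1 hf.1
      · rw [Finset.mem_singleton.1 hf.1]
        exact Set.mem_toFinset.2 heC
    · intro D _
      exact symmDiff_symmDiff_cancel_right _ _
  have hcount : ∀ D, ∑ K : Finset (Set V),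
      (if K ⊆ 𝓕 D ∧ IsChain (· ≤ ·) (K : Set (Set V)) then (1 : ZMod 2) else 0) =
      ((𝓕 D).powerset.filter
        (fun K : Finset (Set V) => IsChain (· ≤ ·) (K : Set (Set V)))).card := by
    intro D
    rw [Finset.sum_boole]
    congr 2
    ext K
    simp
  rw [Finset.sum_eq_single_of_mem ∅ (Finset.empty_mem_powerset _), hcount, hempty] at hzero
  · simp [Finset.filter_singleton] at hzero
  · intro D hD hD0
    rw [hcount]
    exact (ZMod.natCast_eq_zero_iff_even).2 (heven D hD hD0)

/-- (Abstract broadcast.)  For any family of cut functions `F` that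
is submodular and whose values depend only on the edges going out of the cut, if the
rate tuple `(R 1, …, R n)` lies in the cutset region of the broadcast network with edge
set `E₀`, source `s` and destinations `dst 1, …, dst n`, then it lies in the cutset
region of some acyclic subnetwork `E' ⊆ E₀`. -/
theorem exists_acyclic_subnetwork_broadcast {V : Type*} [Fintype V]
    (F : Set (V × V) → Set V → ℝ)
    (hsub : ∀ E : Set (V × V), Submodular (F E))
    (hout : ∀ E E' : Set (V × V), ∀ S : Set V,
      {e ∈ E | e.1 ∈ S ∧ e.2 ∉ S} = {e ∈ E' | e.1 ∈ S ∧ e.2 ∉ S} → F E S = F E' S)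
    (n : ℕ) (s : V) (dst : Fin n → V) (hs : ∀ i, s ≠ dst i)
    (R : Fin n → ℝ) (hR : ∀ i, 0 ≤ R i)
    (E₀ : Set (V × V))
    (hrate : ∀ S : Set V, s ∈ S →
      ∑ i ∈ Finset.univ.filter (fun i => dst i ∉ S), R i ≤ F E₀ S) :
    ∃ E' ⊆ E₀, AcyclicEdgeSet E' ∧
      ∀ S : Set V, s ∈ S →
        ∑ i ∈ Finset.univ.filter (fun i => dst i ∉ S), R i ≤ F E' S := by
  set m : Set V → ℝ := fun S => ∑ i ∈ Finset.univ.filter (fun i => dst i ∉ S), R i with hmdef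
  have hm : ∀ A B, m (A ∪ B) + m (A ∩ B) = m A + m B := by
    intro A B
    simp only [hmdef, Finset.sum_filter, ← Finset.sum_add_distrib]
    refine Finset.sum_congr rfl fun i _ => ?_
    by_cases hA : dst i ∈ A <;> by_cases hB : dst i ∈ B <;> simp [hA, hB]
  obtain ⟨E, hEE₀, hE⟩ := Set.Finite.exists_le_minimal
    (Set.toFinite {E : Set (V × V) | ∀ S, s ∈ S → m S ≤ F E S}) hrate
  refine ⟨E, hEE₀, acyclicEdgeSet_of_minimal F hsub hout s m hm E hE.prop ?_, hE.prop⟩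
  intro D hDE ⟨e, he⟩
  by_contra! hc
  exact (hE.le_of_le hc Set.sdiff_subset (hDE he)).2 he
end
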